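/- Let (X,T) be a minimal topological dynamical system. There is a dense Gδ subset X_0 of X such that for each x ∈ X_0 and every family A = {p_1, …, p_d} of integral polynomials satisfying condition (♠) with deg p_i ≥ 2 for every 1 ≤ i ≤ d, the system (W_x^A, σ) is an M-system, where W_x^A is the closure of the σ-orbit of ω_x^A = ((T^{p_1(n)}x, …, T^{p_d(n)}x))_{n∈ℤ} in (X^d)^ℤ. -/

import Mathlib

open Filter Topology Function Set

/-- Iterates of a homeomorphism indexed by `ℕ`. -/
def hpowNat {X : Type*} [TopologicalSpace X] (T : X ≃ₜ X) : ℕ → X ≃ₜ X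
  | 0 => Homeomorph.refl X
  | n + 1 => (hpowNat T n).trans T

/-- Iterates of a homeomorphism indexed by `ℤ`. -/
def hpowInt {X : Type*} [TopologicalSpace X] (T : X ≃ₜ X) : ℤ → X ≃ₜ X
  | Int.ofNat n => hpowNat T n
  | Int.negSucc n => (hpowNat T (n + 1)).symm

/-- The `n`-th iterate (`n : ℤ`) of the homeomorphism `T`, as a map. -/
def hpow {X : Type*} [TopologicalSpace X] (T : X ≃ₜ X) (n : ℤ) : X → X :=
  ⇑(hpowInt T n)

/-- The (two-sided) orbit of `x` under the homeomorphism `T`. -/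
def zorbit {X : Type*} [TopologicalSpace X] (T : X ≃ₜ X) (x : X) : Set X :=
  Set.range fun n : ℤ => hpow T n x

/-- `(X,T)` is a minimal t.d.s.: every orbit is dense. -/
def IsMinimalTDS {X : Type*} [TopologicalSpace X] (T : X ≃ₜ X) : Prop :=
  ∀ x : X, Dense (zorbit T x)

/-- `z` is a minimal point of `(Z,S)`: its orbit closure is a minimal subsystem, i.e.
every point of the orbit closure of `z` has the same orbit closure as `z`. -/
def IsMinimalPoint {Z : Type*} [TopologicalSpace Z] (S : Z ≃ₜ Z) (z : Z) : Prop :=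
  ∀ w ∈ closure (zorbit S z), closure (zorbit S w) = closure (zorbit S z)

def shiftE (E : Type*) : (ℤ → E) ≃ (ℤ → E) where
  toFun f n := f (n + 1)
  invFun f n := f (n - 1)
  left_inv f := by funext n; simp
  right_inv f := by funext n; simp

/-- The shift homeomorphism `σ` on `ℤ → E`: `(σ f) n = f (n + 1)`. -/
def shiftH (E : Type*) [TopologicalSpace E] : (ℤ → E) ≃ₜ (ℤ → E) where
  toEquiv := shiftE E
  continuous_toFun := continuous_pi fun n => continuous_apply (n + 1)
  continuous_invFun := continuous_pi fun n => continuous_apply (n - 1)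

/-- Condition `(♠)` for a family `p = {p 0, …, p (d-1)}` of integral polynomials:
all vanish at `0`; the first `s` of them are linear `pᵢ n = aᵢ n` with `a₀, …, a_{s-1}`
distinct nonzero integers; the remaining ones have degree at least `2`; and for distinct
nonlinear members, `p_j^{[k]} ≠ p_i^{[t]}` for all `k, t ∈ ℤ`, where
`p^{[j]} n = p (n + j) - p j`. -/
def SpadeCondition {d : ℕ} (p : Fin d → ℤ → ℤ) : Prop :=
  (∀ i, p i 0 = 0) ∧
  ∃ s : ℕ, s ≤ d ∧
    (∃ a : Fin d → ℤ,
      (∀ i : Fin d, (i : ℕ) < s → a i ≠ 0 ∧ ∀ n : ℤ, p i n = a i * n) ∧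
      (∀ i j : Fin d, (i : ℕ) < s → (j : ℕ) < s → i ≠ j → a i ≠ a j)) ∧
    (∀ i : Fin d, s ≤ (i : ℕ) →
      ∃ q : Polynomial ℚ, (∀ n : ℤ, (p i n : ℚ) = q.eval (n : ℚ)) ∧ 2 ≤ q.natDegree) ∧
    (∀ i j : Fin d, s ≤ (i : ℕ) → s ≤ (j : ℕ) → i ≠ j → ∀ k t : ℤ,
      (fun n : ℤ => p j (n + k) - p j k) ≠ (fun n : ℤ => p i (n + t) - p i t))


/-! ### Iterates -/

lemma hpowNat_eq {X : Type*} [TopologicalSpace X] (T : X ≃ₜ X) (n : ℕ) :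
    hpowNat T n = T ^ n := by
  induction n with
  | zero => rfl
  | succ n ih => rw [pow_succ', ← ih]; rfl

lemma hpow_eq {X : Type*} [TopologicalSpace X] (T : X ≃ₜ X) (n : ℤ) :
    hpow T n = ⇑(T ^ n) := by
  unfold hpow
  congr 1
  cases n with
  | ofNat n => simp [hpowInt, hpowNat_eq]
  | negSucc n => rw [zpow_negSucc, ← hpowNat_eq]; rfl

lemma hpow_zero {X : Type*} [TopologicalSpace X] (T : X ≃ₜ X) (x : X) :
    hpow T 0 x = x := by
  rw [hpow_eq, zpow_zero]; rfl

lemma hpow_add {X : Type*} [TopologicalSpace X] (T : X ≃ₜ X) (m n : ℤ) (x : X) :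
    hpow T (m + n) x = hpow T m (hpow T n x) := by
  simp only [hpow_eq, zpow_add]; rfl

lemma hpow_cont {X : Type*} [TopologicalSpace X] (T : X ≃ₜ X) (n : ℤ) :
    Continuous (hpow T n) := (hpowInt T n).continuous

lemma hpow_shift {E : Type*} [TopologicalSpace E] (m : ℤ) (f : ℤ → E) (n : ℤ) :
    hpow (shiftH E) m f n = f (n + m) := by
  have h1 : ∀ (f : ℤ → E) n, hpow (shiftH E) 1 f n = f (n + 1) := by
    intro f n; rw [hpow_eq, zpow_one]; rfl
  have h2 : ∀ (f : ℤ → E) n, hpow (shiftH E) (-1) f n = f (n - 1) := by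
    intro f n; rw [hpow_eq, zpow_neg_one]; rfl
  induction m using Int.induction_on generalizing f n with
  | zero => rw [hpow_zero, add_zero]
  | succ i ih => rw [hpow_add, ih, h1]; congr 1; ring
  | pred i ih => rw [sub_eq_add_neg, hpow_add, ih, h2]; congr 1; ring

/-! ### Polynomial functions through iterated differences -/

/-- `Pd k f`: the function `f` is polynomial of degree `< k`. -/
def Pd : ℕ → (ℤ → ℤ) → Prop
  | 0, f => ∀ n, f n = 0
  | k + 1, f => ∀ h : ℤ, Pd k (fun n => f (n + h) - f n)

lemma Pd.zero' (k : ℕ) : Pd k (fun _ => 0) := by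
  induction k with
  | zero => intro n; rfl
  | succ k ih => intro h; simpa using ih

lemma Pd.succ {k : ℕ} {f : ℤ → ℤ} (hf : Pd k f) : Pd (k + 1) f := by
  induction k generalizing f with
  | zero => intro h n; have := hf n; have := hf (n + h); simp_all
  | succ k ih => intro h; exact ih (hf h)

lemma Pd.mono {k l : ℕ} (hkl : k ≤ l) {f : ℤ → ℤ} (hf : Pd k f) : Pd l f := by
  induction hkl with
  | refl => exact hf
  | step _ ih => exact ih.succ

lemma Pd.const (k : ℕ) (c : ℤ) : Pd (k + 1) (fun _ => c) := by
  intro h; simpa using Pd.zero' k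

lemma Pd.add {k : ℕ} {f g : ℤ → ℤ} (hf : Pd k f) (hg : Pd k g) :
    Pd k (fun n => f n + g n) := by
  induction k generalizing f g with
  | zero => intro n; have := hf n; have := hg n; simp_all
  | succ k ih =>
    intro h
    have := ih (hf h) (hg h)
    convert this using 2
    ring

lemma Pd.neg {k : ℕ} {f : ℤ → ℤ} (hf : Pd k f) :
    Pd k (fun n => - f n) := by
  induction k generalizing f with
  | zero => intro n; have := hf n; simp_all
  | succ k ih =>
    intro h
    have := ih (hf h)
    convert this using 2
    ring

lemma Pd.sub {k : ℕ} {f g : ℤ → ℤ} (hf : Pd k f) (hg : Pd k g) :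
    Pd k (fun n => f n - g n) := by
  have := hf.add hg.neg
  simpa [sub_eq_add_neg] using this

lemma Pd.shift {k : ℕ} {f : ℤ → ℤ} (hf : Pd k f) (c : ℤ) :
    Pd k (fun n => f (n + c)) := by
  induction k generalizing f with
  | zero => intro n; exact hf _
  | succ k ih =>
    intro h
    have := ih (hf h)
    convert this using 3
    ring_nf

lemma Pd_of_poly (k : ℕ) : ∀ (q : Polynomial ℚ) (f : ℤ → ℤ), q.degree < (k : ℕ) →
    (∀ n : ℤ, (f n : ℚ) = q.eval (n : ℚ)) → Pd k f := by
  induction k with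
  | zero =>
    intro q f hq hf n
    have : q = 0 := by
      by_contra h
      have := Polynomial.zero_le_degree_iff.2 h
      exact absurd hq (not_lt.2 (by simpa using this))
    have := hf n
    simp_all
  | succ k ih =>
    intro q f hq hf h
    refine ih (Polynomial.taylor (h : ℚ) q - q) _ ?_ ?_
    · by_cases h0 : q = 0
      · subst h0; simp
      · have h1 : (Polynomial.taylor (h : ℚ) q - q).degree < q.degree := by
          have := Polynomial.degree_sub_lt_left (p := Polynomial.taylor (h : ℚ) q) (q := q)
            (Polynomial.degree_taylor _ _) (by simpa using h0) (by simp)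
          simpa using this
        have h2 : q.degree ≤ (k : ℕ) := by
          rw [Polynomial.degree_eq_natDegree h0] at hq ⊢
          norm_cast at hq ⊢
          omega
        exact lt_of_lt_of_le h1 h2
    · intro n
      push_cast
      rw [hf, hf, Polynomial.eval_sub, Polynomial.taylor_eval]
      push_cast
      ring_nf

lemma countable_Pd (k : ℕ) : {f : ℤ → ℤ | Pd k f}.Countable := by
  induction k with
  | zero =>
    refine Set.Countable.mono (s₂ := {fun _ => 0}) ?_ (Set.countable_singleton _)
    intro f hf; exact funext hf
  | succ k ih =>
    refine Set.MapsTo.countable_of_injOn (f := fun f : ℤ → ℤ => (f 0, fun n => f (n + 1) - f n))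
      (t := (Set.univ : Set ℤ) ×ˢ {f : ℤ → ℤ | Pd k f}) ?_ ?_
      (Set.countable_univ.prod ih)
    · intro f hf; exact ⟨trivial, hf 1⟩
    · intro f _ g _ hfg
      simp only [Prod.mk.injEq] at hfg
      obtain ⟨h0, h1⟩ := hfg
      funext n
      induction n using Int.induction_on with
      | zero => exact h0
      | succ i ih => have := congrFun h1 i; linarith
      | pred i ih =>
        have := congrFun h1 (-i - 1)
        simp only [sub_add_cancel] at this; linarith

/-! ### The PET induction scheme -/

/-- One step of the PET induction: remove `s`, subtract it from all others, and take shifts. -/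
def stepSet (s : ℤ → ℤ) (M : Set ℤ) (F : Set (ℤ → ℤ)) : Set (ℤ → ℤ) :=
  {f | ∃ q ∈ F, q ≠ s ∧ ∃ c ∈ M, f = fun m => (q (m + c) - s (m + c)) - (q c - s c)}

inductive Sol : Set (ℤ → ℤ) → Prop
  | empty : Sol ∅
  | step (F : Set (ℤ → ℤ)) (s : ℤ → ℤ) (hs : s ∈ F)
      (h : ∀ M : Set ℤ, M.Finite → Sol (stepSet s M F)) : Sol F

lemma stepSet_Pd {k : ℕ} {s : ℤ → ℤ} {M : Set ℤ} {F : Set (ℤ → ℤ)} (hs : Pd (k + 1) s)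
    (hF : ∀ q ∈ F, Pd (k + 1) q) : ∀ q ∈ stepSet s M F, Pd (k + 1) q ∧ q 0 = 0 := by
  rintro f ⟨q, hq, -, c, -, rfl⟩
  refine ⟨(((hF q hq).shift c).sub (hs.shift c)).sub (Pd.const k _), by simp⟩

lemma stepSet_finite {s : ℤ → ℤ} {M : Set ℤ} {F : Set (ℤ → ℤ)} (hM : M.Finite)
    (hF : F.Finite) : (stepSet s M F).Finite := by
  refine (Set.Finite.image2 (fun (q : ℤ → ℤ) (c : ℤ) =>
    fun m => (q (m + c) - s (m + c)) - (q c - s c)) hF hM).subset ?_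
  rintro f ⟨q, hq, -, c, hc, rfl⟩
  exact ⟨q, hq, c, hc, rfl⟩

lemma stepSet_union (s : ℤ → ℤ) (M : Set ℤ) (F G : Set (ℤ → ℤ)) :
    stepSet s M (F ∪ G) = stepSet s M F ∪ stepSet s M G := by
  ext f; constructor
  · rintro ⟨q, hq | hq, h⟩
    · exact Or.inl ⟨q, hq, h⟩
    · exact Or.inr ⟨q, hq, h⟩
  · rintro (⟨q, hq, h⟩ | ⟨q, hq, h⟩)
    · exact ⟨q, Or.inl hq, h⟩
    · exact ⟨q, Or.inr hq, h⟩

lemma Sol_of_shear (F : Set (ℤ → ℤ)) (r : ℤ → ℤ)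
    (h : Sol ((fun q => q - r) '' F)) : Sol F := by
  rcases F.eq_empty_or_nonempty with rfl | ⟨q0, hq0⟩
  · exact Sol.empty
  generalize hG : (fun q => q - r) '' F = G at h
  cases h with
  | empty => exact absurd (hG ▸ Set.mem_image_of_mem _ hq0) (Set.notMem_empty _)
  | step _ s hs h =>
    rw [← hG] at hs
    obtain ⟨s', hs', rfl⟩ := hs
    refine Sol.step F s' hs' fun M hM => ?_
    convert h M hM using 1
    rw [← hG]
    ext f; constructor
    · rintro ⟨q, hq, hne, c, hc, rfl⟩
      refine ⟨q - r, ⟨q, hq, rfl⟩, fun e => hne (sub_left_injective e), c, hc, ?_⟩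
      funext m; simp
    · rintro ⟨_, ⟨q, hq, rfl⟩, hne, c, hc, rfl⟩
      refine ⟨q, hq, fun e => hne (by rw [e]), c, hc, ?_⟩
      funext m; simp

lemma Sol_union {k n : ℕ}
    (H : ∀ (G : Set (ℤ → ℤ)) (rs : List (ℤ → ℤ)), G.Finite → rs.length = n → (∀ r ∈ rs, r 0 = 0) →
      (∀ q ∈ G, Pd (k + 2) q ∧ q 0 = 0) → (∀ g ∈ G, ∃ r ∈ rs, Pd (k + 1) (g - r)) → Sol G)
    {F : Set (ℤ → ℤ)} (hF : Sol F) :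
    (∀ q ∈ F, Pd (k + 2) q ∧ q 0 = 0) →
    ∀ (G : Set (ℤ → ℤ)) (rs : List (ℤ → ℤ)), G.Finite → rs.length = n → (∀ r ∈ rs, r 0 = 0) →
      (∀ q ∈ G, Pd (k + 2) q ∧ q 0 = 0) → (∀ g ∈ G, ∃ r ∈ rs, Pd (k + 1) (g - r)) →
      Sol (F ∪ G) := by
  induction hF with
  | empty => intro _ G rs h0 h1 h2 h3 h4; rw [Set.empty_union]; exact H G rs h0 h1 h2 h3 h4
  | step F s hs h ih =>
    intro hF G rs h0 h1 h2 h3 h4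
    refine Sol.step _ s (Or.inl hs) fun M hM => ?_
    rw [stepSet_union]
    refine ih M hM (stepSet_Pd (hF s hs).1 fun q hq => (hF q hq).1) _ (rs.map (fun r => r - s))
      (stepSet_finite hM h0) (by simpa using h1) ?_ (stepSet_Pd (hF s hs).1 fun q hq => (h3 q hq).1) ?_
    · intro r hr
      obtain ⟨r', hr', rfl⟩ := List.mem_map.1 hr
      simp [h2 r' hr', (hF s hs).2]
    · rintro f ⟨q, hq, -, c, -, rfl⟩
      obtain ⟨r, hr, hqr⟩ := h4 q hq
      refine ⟨r - s, List.mem_map.2 ⟨r, hr, rfl⟩, ?_⟩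
      have e1 : Pd (k + 1) (fun m => q (m + c) - q m) := (h3 q hq).1 c
      have e2 : Pd (k + 1) (fun m => s (m + c) - s m) := (hF s hs).1 c
      have := ((e1.sub e2).sub (Pd.const k (q c - s c))).add hqr
      convert this using 1
      funext m
      simp only [Pi.sub_apply]
      ring

lemma Sol_all (k : ℕ) : ∀ F : Set (ℤ → ℤ), F.Finite → (∀ q ∈ F, Pd (k + 1) q ∧ q 0 = 0) →
    Sol F := by
  induction k with
  | zero =>
    intro F _ hF
    have hz : ∀ q ∈ F, q = fun _ => 0 := by
      intro q hq
      funext n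
      have := (hF q hq).1 n 0
      simp only [zero_add, (hF q hq).2] at this
      linarith
    rcases F.eq_empty_or_nonempty with rfl | ⟨q0, hq0⟩
    · exact Sol.empty
    refine Sol.step F q0 hq0 fun M _ => ?_
    convert Sol.empty
    ext f
    simp only [Set.mem_empty_iff_false, iff_false]
    rintro ⟨q, hq, hne, -⟩
    exact hne ((hz q hq).trans (hz q0 hq0).symm)
  | succ k ih =>
    have key : ∀ (n : ℕ) (G : Set (ℤ → ℤ)) (rs : List (ℤ → ℤ)), G.Finite →
        rs.length = n → (∀ r ∈ rs, r 0 = 0) →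
        (∀ q ∈ G, Pd (k + 2) q ∧ q 0 = 0) → (∀ g ∈ G, ∃ r ∈ rs, Pd (k + 1) (g - r)) → Sol G := by
      intro n
      induction n with
      | zero =>
        intro G rs _ hlen _ _ h4
        obtain rfl := List.length_eq_zero_iff.1 hlen
        have : G = ∅ := by
          ext g
          simp only [Set.mem_empty_iff_false, iff_false]
          intro hg
          obtain ⟨r, hr, -⟩ := h4 g hg
          simp at hr
        rw [this]; exact Sol.empty
      | succ n ihn =>
        intro G rs h0 hlen h2 h3 h4
        match rs, hlen with
        | r :: rs, hlen =>
          have hr0 : r 0 = 0 := h2 r (by simp)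
          have e : G = {g ∈ G | Pd (k + 1) (g - r)} ∪
              {g ∈ G | ∃ r' ∈ rs, Pd (k + 1) (g - r')} := by
            ext g; constructor
            · intro hg
              obtain ⟨r', hr', h⟩ := h4 g hg
              rcases List.mem_cons.1 hr' with rfl | hr'
              · exact Or.inl ⟨hg, h⟩
              · exact Or.inr ⟨hg, r', hr', h⟩
            · rintro (h | h) <;> exact h.1
          rw [e]
          refine Sol_union ihn (F := {g ∈ G | Pd (k + 1) (g - r)}) ?_ (fun q hq => h3 q hq.1) _ rs
            (h0.subset (Set.sep_subset _ _)) (by simpa using hlen)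
            (fun r' hr' => h2 r' (List.mem_cons_of_mem _ hr')) (fun q hq => h3 q hq.1)
            (fun q hq => hq.2)
          refine Sol_of_shear _ r (ih _ ((h0.subset (Set.sep_subset _ _)).image _) ?_)
          rintro _ ⟨q, hq, rfl⟩
          exact ⟨hq.2, by simp [(h3 q hq.1).2, hr0]⟩
    intro F hfin hF
    obtain ⟨l, hl⟩ : ∃ l : List (ℤ → ℤ), ∀ q, q ∈ l ↔ q ∈ F := by
      classical
      exact ⟨hfin.toFinset.toList, by simp⟩
    refine key l.length F l hfin rfl (fun r hr => (hF r ((hl r).1 hr)).2) hF ?_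
    intro g hg
    exact ⟨g, (hl g).2 hg, by rw [sub_self]; exact Pd.zero' (k + 1)⟩

/-! ### The groups of polynomial shears of `ℤ × ℤ` -/

/-- Maps `(a, m) ↦ (a + Q m, m + l)` with `deg Q ≤ k`. -/
def Lam (k : ℕ) : Subgroup (Equiv.Perm (ℤ × ℤ)) where
  carrier := {g | ∃ (Q : ℤ → ℤ) (l : ℤ), Pd (k + 1) Q ∧ ∀ z, g z = (z.1 + Q z.2, z.2 + l)}
  one_mem' := ⟨fun _ => 0, 0, Pd.zero' _, fun z => by simp⟩
  mul_mem' := by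
    rintro g h ⟨Q, l, hQ, hg⟩ ⟨R, j, hR, hh⟩
    refine ⟨fun m => R m + Q (m + j), j + l, hR.add (hQ.shift j), fun z => ?_⟩
    simp only [Equiv.Perm.mul_apply, hh, hg, Prod.mk.injEq]
    constructor <;> ring
  inv_mem' := by
    rintro g ⟨Q, l, hQ, hg⟩
    refine ⟨fun m => - Q (m + -l), -l, (hQ.shift (-l)).neg, fun z => ?_⟩
    rw [Equiv.Perm.inv_eq_iff_eq, hg]
    ext <;> simp

/-- The shear by `Q` combined with the translation by `l`. -/
def lam (Q : ℤ → ℤ) (l : ℤ) : Equiv.Perm (ℤ × ℤ) where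
  toFun z := (z.1 + Q z.2, z.2 + l)
  invFun z := (z.1 - Q (z.2 - l), z.2 - l)
  left_inv z := by simp
  right_inv z := by simp

lemma lam_apply (Q : ℤ → ℤ) (l : ℤ) (z : ℤ × ℤ) : lam Q l z = (z.1 + Q z.2, z.2 + l) := rfl

lemma lam_mem {k : ℕ} {Q : ℤ → ℤ} (l : ℤ) (hQ : Pd (k + 1) Q) : lam Q l ∈ Lam k :=
  ⟨Q, l, hQ, fun _ => rfl⟩

lemma Lam_le (k : ℕ) : Lam k ≤ Lam (k + 1) := by
  rintro g ⟨Q, l, hQ, hg⟩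
  exact ⟨Q, l, hQ.succ, hg⟩

lemma Lam_normal (k : ℕ) (g h : Equiv.Perm (ℤ × ℤ)) (hg : g ∈ Lam (k + 1)) (hh : h ∈ Lam k) :
    g * h * g⁻¹ ∈ Lam k := by
  obtain ⟨R, l, hR, hg⟩ := hg
  obtain ⟨Q, j, hQ, hh⟩ := hh
  have hinv : ∀ z, g⁻¹ z = (z.1 - R (z.2 + -l), z.2 + -l) := by
    intro z
    rw [Equiv.Perm.inv_eq_iff_eq, hg]
    ext <;> simp
  refine ⟨fun m => (R (m + -l + j) - R (m + -l)) + Q (m + -l), j,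
    (Pd.shift (f := fun m => R (m + j) - R m) (hR j) (-l)).add (hQ.shift (-l)), fun z => ?_⟩
  simp only [Equiv.Perm.mul_apply, hinv, hh, hg, Prod.mk.injEq]
  constructor <;> ring

/-- Finitely many translates of `E` by `Lam D` cover. -/
def Synd (D : ℕ) (E : Set (ℤ × ℤ)) : Prop :=
  ∃ A : Set (Equiv.Perm (ℤ × ℤ)), A.Finite ∧ (∀ g ∈ A, g ∈ Lam D) ∧ ∀ z, ∃ g ∈ A, g z ∈ E

lemma Synd.meets {D : ℕ} {S E : Set (ℤ × ℤ)} (hS : Synd D S) (hE : ¬ Synd D E)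
    {B : Set (Equiv.Perm (ℤ × ℤ))} (hB : B.Finite) (hB' : ∀ g ∈ B, g ∈ Lam D) :
    ∃ z ∈ S, ∀ g ∈ B, g z ∉ E := by
  by_contra hcon
  push Not at hcon
  obtain ⟨A, hA, hA', hA''⟩ := hS
  refine hE ⟨Set.image2 (fun g h => g * h) B A, hB.image2 _ hA, ?_, ?_⟩
  · rintro _ ⟨g, hg, h, hh, rfl⟩
    exact mul_mem (hB' g hg) (hA' h hh)
  · intro z
    obtain ⟨h, hh, hz⟩ := hA'' z
    obtain ⟨g, hg, hz'⟩ := hcon _ hz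
    exact ⟨g * h, ⟨g, hg, h, hh, rfl⟩, hz'⟩

lemma exists_cover {X : Type*} [TopologicalSpace X] [CompactSpace X] {T : X ≃ₜ X}
    (hT : IsMinimalTDS T) {V : Set X} (hV : IsOpen V) (hne : V.Nonempty) :
    ∃ K : Finset ℤ, ∀ y, ∃ c ∈ K, hpow T (-c) y ∈ V := by
  obtain ⟨t, ht⟩ := isCompact_univ.elim_finite_subcover (fun c : ℤ => hpow T (-c) ⁻¹' V)
    (fun c => hV.preimage (hpow_cont T _)) (by
      intro y _
      obtain ⟨_, hv, n, rfl⟩ := (hT y).inter_open_nonempty V hV hne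
      exact Set.mem_iUnion.2 ⟨-n, by simpa using hv⟩)
  refine ⟨t, fun y => ?_⟩
  obtain ⟨c, hc, h⟩ := Set.mem_iUnion₂.1 (ht (Set.mem_univ y))
  exact ⟨c, hc, h⟩

/-- Polynomial van der Waerden in the strong form: the good pairs `(a, m)` are syndetic for
the group of polynomial shears. -/
theorem good_of_sol {X : Type*} [TopologicalSpace X] [CompactSpace X] {T : X ≃ₜ X}
    (hT : IsMinimalTDS T) (x : X) (D : ℕ) {F : Set (ℤ → ℤ)} (hF : Sol F) :
    F.Finite → (∀ q ∈ F, Pd (D + 1) q ∧ q 0 = 0) → ∀ V : Set X, IsOpen V → V.Nonempty →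
      Synd D {z | ∀ q ∈ F, hpow T (z.1 + q z.2) x ∈ V} := by
  induction hF with
  | empty =>
    intro _ _ V _ _
    exact ⟨{1}, Set.finite_singleton _, by simp [one_mem], fun z => ⟨1, rfl, by simp⟩⟩
  | step F s hs h ih =>
    intro hfin hF V hV hne
    by_contra hE
    set E : Set (ℤ × ℤ) := {z | ∀ q ∈ F, hpow T (z.1 + q z.2) x ∈ V} with hEdef
    obtain ⟨K, hK⟩ := exists_cover hT hV hne
    have key : ∀ j : ℕ, ∃ (C : Finset ℤ) (M : ℤ → ℤ) (U : Set X), C ⊆ K ∧ C.card = j ∧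
        IsOpen U ∧ U.Nonempty ∧
        ∀ c ∈ C, ∀ q ∈ F, q ≠ s → ∀ y ∈ U, hpow T (q (M c) - s (M c) - c) y ∈ V := by
      intro j
      induction j with
      | zero => exact ⟨∅, fun _ => 0, Set.univ, by simp, rfl, isOpen_univ, ⟨x, trivial⟩, by simp⟩
      | succ j ihj =>
        obtain ⟨C, M, U, hCK, hcard, hU, hUne, hC⟩ := ihj
        have hMfin : (M '' (C : Set ℤ)).Finite := C.finite_toSet.image M
        have hS := ih (M '' (C : Set ℤ)) hMfin (stepSet_finite hMfin hfin)
          (stepSet_Pd (hF s hs).1 fun q hq => (hF q hq).1) U hU hUne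
        obtain ⟨⟨b, m⟩, hz, hzE⟩ := hS.meets hE
          (B := (fun c : ℤ => (lam s 0)⁻¹ * lam (fun _ => -c) (M c)) '' (C : Set ℤ))
          (C.finite_toSet.image _) (by
            rintro _ ⟨c, _, rfl⟩
            exact mul_mem (inv_mem (lam_mem 0 (hF s hs).1)) (lam_mem _ (Pd.const D _)))
        have hz' : ∀ q ∈ F, q ≠ s → ∀ c ∈ C,
            hpow T (b + ((q (m + M c) - s (m + M c)) - (q (M c) - s (M c)))) x ∈ U := by
          intro q hq hqs c hc
          exact hz _ ⟨q, hq, hqs, M c, ⟨c, hc, rfl⟩, rfl⟩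
        have hzE' : ∀ c ∈ C, ∃ q ∈ F, hpow T (b - c + (q (m + M c) - s (m + M c))) x ∉ V := by
          intro c hc
          have := hzE _ ⟨c, hc, rfl⟩
          have e : ((lam s 0)⁻¹ * lam (fun _ => -c) (M c)) (b, m)
              = (b - c - s (m + M c), m + M c) := by
            rw [Equiv.Perm.mul_apply, Equiv.Perm.inv_eq_iff_eq]
            simp only [lam_apply]
            ext <;> simp <;> ring
          simp only [e, hEdef, Set.mem_ofPred_eq, not_forall] at this
          obtain ⟨q, hq, hqV⟩ := this
          refine ⟨q, hq, ?_⟩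
          convert hqV using 3
          ring
        obtain ⟨c', hc'K, hc'⟩ := hK (hpow T b x)
        -- the new open set
        let U' : Set X := (hpow T (-c') ⁻¹' V) ∩
          ⋂ q ∈ {q ∈ F | q ≠ s}, ⋂ c ∈ C,
            hpow T ((q (m + M c) - s (m + M c)) - (q (M c) - s (M c))) ⁻¹' U
        have hU'open : IsOpen U' := by
          refine (hV.preimage (hpow_cont T _)).inter ?_
          refine (hfin.subset (Set.sep_subset _ _)).isOpen_biInter fun q _ => ?_
          exact isOpen_biInter_finset fun c _ => hU.preimage (hpow_cont T _)
        have hbU' : hpow T b x ∈ U' := by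
          refine ⟨hc', ?_⟩
          simp only [Set.mem_iInter, Set.mem_preimage]
          intro q hq c hc
          rw [← hpow_add, add_comm]
          exact hz' q hq.1 hq.2 c hc
        have hgood : ∀ c ∈ C, ∀ q ∈ F, q ≠ s → ∀ y ∈ U',
            hpow T (q (m + M c) - s (m + M c) - c) y ∈ V := by
          intro c hc q hq hqs y hy
          have h1 := hy.2
          simp only [Set.mem_iInter, Set.mem_preimage] at h1
          have h2 := hC c hc q hq hqs _ (h1 q ⟨hq, hqs⟩ c hc)
          rw [← hpow_add] at h2
          convert h2 using 2
          ring
        have hc'C : c' ∉ C := by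
          intro hc
          obtain ⟨q, hq, hqV⟩ := hzE' c' hc
          apply hqV
          by_cases hqs : q = s
          · subst hqs
            rw [← hpow_add] at hc'
            convert hc' using 2
            ring
          · have := hgood c' hc q hq hqs _ hbU'
            rw [← hpow_add] at this
            convert this using 2
            ring
        classical
        refine ⟨insert c' C, fun c => if c = c' then 0 else m + M c, U', ?_, ?_, hU'open,
          ⟨_, hbU'⟩, ?_⟩
        · exact Finset.insert_subset hc'K hCK
        · rw [Finset.card_insert_of_notMem hc'C, hcard]
        · intro c hc q hq hqs y hy
          by_cases hcc : c = c'
          · subst hcc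
            simp only [if_true, (hF q hq).2, (hF s hs).2, sub_self, zero_sub]
            exact hy.1
          · simp only [hcc, if_false]
            exact hgood c ((Finset.mem_insert.1 hc).resolve_left hcc) q hq hqs y hy
    obtain ⟨C, _, _, hCK, hcard, _⟩ := key (K.card + 1)
    have := Finset.card_le_card hCK
    omega

/-! ### Minimal invariant filters -/

section filters
variable {α : Type*}

def InvF (G : Subgroup (Equiv.Perm α)) (f : Filter α) : Prop :=
  ∀ g ∈ G, ∀ s ∈ f, {z | g z ∈ s} ∈ f

def MinF (G : Subgroup (Equiv.Perm α)) (f : Filter α) : Prop :=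
  f.NeBot ∧ InvF G f ∧ ∀ f' ≤ f, f'.NeBot → InvF G f' → f ≤ f'

lemma exists_minF (G : Subgroup (Equiv.Perm α)) (f : Filter α) (h1 : f.NeBot) (h2 : InvF G f) :
    ∃ m ≤ f, MinF G m := by
  obtain ⟨m, hm, hmax⟩ := zorn_le_nonempty₀ (α := (Filter α)ᵒᵈ)
    {u | (OrderDual.ofDual u).NeBot ∧ InvF G (OrderDual.ofDual u)} (by
      intro c hc hchain y hy
      have hne : Nonempty α := by
        obtain ⟨z, -⟩ := ((hc hy).1.nonempty_of_mem univ_mem); exact ⟨z⟩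
      let c' : Set (Filter α) := OrderDual.ofDual '' c
      have hdir : DirectedOn (· ≥ ·) c' := by
        rintro _ ⟨u, hu, rfl⟩ _ ⟨v, hv, rfl⟩
        rcases hchain.total hu hv with h | h
        · exact ⟨_, ⟨v, hv, rfl⟩, h, le_refl _⟩
        · exact ⟨_, ⟨u, hu, rfl⟩, le_refl _, h⟩
      have hc'ne : c'.Nonempty := ⟨_, y, hy, rfl⟩
      have hmem : ∀ s, s ∈ sInf c' ↔ ∃ u ∈ c', s ∈ u := by
        intro s
        rw [sInf_eq_iInf]
        exact Filter.mem_biInf_of_directed (f := fun u => u) hdir hc'ne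
      refine ⟨OrderDual.toDual (sInf c'), ⟨?_, ?_⟩, ?_⟩
      · refine Filter.sInf_neBot_of_directed hdir ?_
        rintro ⟨u, hu, h⟩
        exact (hc hu).1.ne h
      · intro g hg s hs
        rw [OrderDual.ofDual_toDual] at hs ⊢
        obtain ⟨_, ⟨u, hu, rfl⟩, hsu⟩ := (hmem s).1 hs
        exact (hmem _).2
          ⟨_, ⟨u, hu, rfl⟩, (hc hu).2 g hg s hsu⟩
      · intro z hz
        have hz' : OrderDual.ofDual z ∈ c' := ⟨z, hz, rfl⟩
        have h : sInf c' ≤ OrderDual.ofDual z := sInf_le hz'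
        exact h)
    (OrderDual.toDual f) ⟨h1, h2⟩
  refine ⟨OrderDual.ofDual m, hm, hmax.prop.1, hmax.prop.2, fun f' hf' hb hi => ?_⟩
  exact hmax.le_of_ge (y := OrderDual.toDual f') ⟨hb, hi⟩ hf'

lemma MinF.cover {G : Subgroup (Equiv.Perm α)} {f : Filter α} (hf : MinF G f) {E : Set α}
    (hE : ∃ᶠ z in f, z ∈ E) :
    ∃ A : Set (Equiv.Perm α), A.Finite ∧ (∀ g ∈ A, g ∈ G) ∧ ∀ᶠ z in f, ∃ g ∈ A, g z ∈ E := by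
  by_contra hcon
  let f' : Filter α :=
    { sets := {s | ∃ A : Set (Equiv.Perm α), A.Finite ∧ (∀ g ∈ A, g ∈ G) ∧
        ∀ᶠ z in f, (∀ g ∈ A, g z ∉ E) → z ∈ s}
      univ_sets := ⟨∅, Set.finite_empty, by simp, by simp⟩
      sets_of_superset := by
        rintro s t ⟨A, h1, h2, h3⟩ hst
        exact ⟨A, h1, h2, h3.mono fun z hz h => hst (hz h)⟩
      inter_sets := by
        rintro s t ⟨A, h1, h2, h3⟩ ⟨B, h1', h2', h3'⟩
        refine ⟨A ∪ B, h1.union h1', ?_, ?_⟩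
        · rintro g (hg | hg)
          · exact h2 g hg
          · exact h2' g hg
        · filter_upwards [h3, h3'] with z hz hz' h
          exact ⟨hz fun g hg => h g (Or.inl hg), hz' fun g hg => h g (Or.inr hg)⟩ }
  have hle : f' ≤ f := by
    intro s hs
    exact ⟨∅, Set.finite_empty, by simp, by filter_upwards [hs] with z hz _ using hz⟩
  have hb : f'.NeBot := by
    refine Filter.neBot_iff.2 fun h => ?_
    have : ∅ ∈ f' := Filter.empty_mem_iff_bot.2 h
    obtain ⟨A, h1, h2, h3⟩ := this
    refine hcon ⟨A, h1, h2, ?_⟩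
    filter_upwards [h3] with z hz
    by_contra h
    push Not at h
    exact hz h
  have hi : InvF G f' := by
    rintro h hh s ⟨A, h1, h2, h3⟩
    refine ⟨(fun g => g * h) '' A, h1.image _, ?_, ?_⟩
    · rintro _ ⟨g, hg, rfl⟩; exact mul_mem (h2 g hg) hh
    · have := hf.2.1 h hh _ h3
      filter_upwards [this] with z hz h'
      exact hz fun g hg => h' _ ⟨g, hg, rfl⟩
  have h1 := hf.2.2 f' hle hb hi
  have h2 : Eᶜ ∈ f' := ⟨{1}, Set.finite_singleton _, by simp [one_mem], by
    filter_upwards with z hz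
    exact hz 1 rfl⟩
  exact hE (h1 h2)

lemma MinF.map {H : Subgroup (Equiv.Perm α)} {f : Filter α} (hf : MinF H f)
    (g : Equiv.Perm α) (hg : ∀ h ∈ H, g * h * g⁻¹ ∈ H) (hg' : ∀ h ∈ H, g⁻¹ * h * g ∈ H) :
    MinF H (f.map g) := by
  refine ⟨hf.1.map _, ?_, ?_⟩
  · intro h hh s hs
    have := hf.2.1 _ (hg' h hh) _ hs
    rw [Filter.mem_map]
    convert this using 1
    ext z
    simp [Equiv.Perm.mul_apply]
  · intro f' hle hb hi
    have h1 : f'.map (g⁻¹ : Equiv.Perm α) ≤ f := by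
      intro s hs
      have : g '' s ∈ f' := hle (by
        rw [Filter.mem_map, Set.preimage_image_eq _ g.injective]; exact hs)
      rw [Filter.mem_map]
      filter_upwards [this]
      rintro _ ⟨z, hz, rfl⟩
      simpa using hz
    have h2 := hf.2.2 _ h1 (hb.map _) (by
      intro h hh s hs
      have := hi _ (hg h hh) _ hs
      rw [Filter.mem_map]
      convert this using 1
      ext z
      simp [Equiv.Perm.mul_apply])
    intro s hs
    rw [Filter.mem_map]
    apply h2
    rw [Filter.mem_map]
    filter_upwards [hs] with z hz
    simpa using hz

lemma MinF.descend {H G : Subgroup (Equiv.Perm α)} (hHG : H ≤ G)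
    (hn : ∀ g ∈ G, ∀ h ∈ H, g * h * g⁻¹ ∈ H) {f : Filter α} (hf : MinF G f) {E : Set α}
    (hE : ∃ᶠ z in f, z ∈ E) : ∃ f', MinF H f' ∧ ∃ᶠ z in f', z ∈ E := by
  obtain ⟨A, h1, h2, h3⟩ := hf.cover hE
  obtain ⟨m, hm, hmin⟩ := exists_minF H f hf.1 (fun g hg => hf.2.1 g (hHG hg))
  have h4 : ∀ᶠ z in m, ∃ g ∈ A, g z ∈ E := hm h3
  obtain ⟨g, hg, h5⟩ : ∃ g ∈ A, ∃ᶠ z in m, g z ∈ E := by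
    by_contra hcon
    push Not at hcon
    have : ∀ᶠ z in m, ∀ g ∈ A, g z ∉ E := (Filter.eventually_all_finite h1).2 fun g hg => by
      simpa using hcon g hg
    have hb := hmin.1
    obtain ⟨z, hz, g, hg, hz'⟩ := (this.and h4).exists
    exact hz g hg hz'
  refine ⟨m.map g, hmin.map g (hn g (h2 g hg)) ?_, ?_⟩
  · intro h hh
    simpa using hn g⁻¹ (inv_mem (h2 g hg)) h hh
  · rw [Filter.frequently_map]; exact h5

end filters

lemma Synd.exists_minF {D : ℕ} {E : Set (ℤ × ℤ)} (hE : Synd D E) :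
    ∃ f, MinF (Lam 0) f ∧ ∃ᶠ z in f, z ∈ E := by
  have h0 : ∃ f, MinF (Lam D) f ∧ ∃ᶠ z in f, z ∈ E := by
    obtain ⟨A, h1, h2, h3⟩ := hE
    obtain ⟨m, -, hm⟩ := _root_.exists_minF (Lam D) ⊤ inferInstance (by
      intro g _ s hs
      rw [Filter.mem_top] at hs ⊢
      subst hs; rfl)
    refine ⟨m, hm, fun hcon => ?_⟩
    have : ∀ᶠ z in m, ∀ g ∈ A, g z ∉ E := (Filter.eventually_all_finite h1).2 fun g hg =>
      hm.2.1 g (h2 g hg) _ hcon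
    have hb := hm.1
    obtain ⟨z, hz⟩ := this.exists
    obtain ⟨g, hg, hz'⟩ := h3 z
    exact hz g hg hz'
  clear hE
  induction D with
  | zero => exact h0
  | succ D ih =>
    obtain ⟨f, hf, hfE⟩ := h0
    exact ih (hf.descend (Lam_le D) (fun g hg h hh => Lam_normal D g h hg hh) hfE)

/-! ### Piecewise syndetic returns for generic points -/

/-- Points `y` whose return times to `V` along `F` are `r`-dense in some interval of radius `L`. -/
def Av {X : Type*} [TopologicalSpace X] (T : X ≃ₜ X) (F : Set (ℤ → ℤ)) (V : Set X) (r L : ℕ) :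
    Set X :=
  {y | ∃ m : ℤ, ∀ l ∈ Set.Icc (-(L : ℤ)) L, ∃ f ∈ Set.Icc (-(r : ℤ)) r, ∀ q ∈ F,
    hpow T (q (m + l + f)) y ∈ V}

lemma Av_open {X : Type*} [TopologicalSpace X] (T : X ≃ₜ X) {F : Set (ℤ → ℤ)} (hF : F.Finite)
    {V : Set X} (hV : IsOpen V) (r L : ℕ) : IsOpen (Av T F V r L) := by
  have : Av T F V r L = ⋃ m : ℤ, ⋂ l ∈ Set.Icc (-(L : ℤ)) L, ⋃ f ∈ Set.Icc (-(r : ℤ)) r,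
      ⋂ q ∈ F, hpow T (q (m + l + f)) ⁻¹' V := by
    ext y
    simp only [Av, Set.mem_iUnion, Set.mem_iInter, Set.mem_preimage, exists_prop,
      Set.mem_ofPred_eq]
  rw [this]
  refine isOpen_iUnion fun m => (Set.finite_Icc _ _).isOpen_biInter fun l _ =>
    isOpen_biUnion fun f _ => hF.isOpen_biInter fun q _ => hV.preimage (hpow_cont T _)

/-- Translations in the second coordinate. -/
def Sig : Subgroup (Equiv.Perm (ℤ × ℤ)) where
  carrier := {g | ∃ l : ℤ, ∀ z, g z = (z.1, z.2 + l)}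
  one_mem' := ⟨0, fun z => by simp⟩
  mul_mem' := by
    rintro g h ⟨l, hg⟩ ⟨j, hh⟩
    refine ⟨j + l, fun z => ?_⟩
    simp only [Equiv.Perm.mul_apply, hh, hg, add_assoc]
  inv_mem' := by
    rintro g ⟨l, hg⟩
    refine ⟨-l, fun z => ?_⟩
    rw [Equiv.Perm.inv_eq_iff_eq, hg]
    ext <;> simp

lemma Sig_le : Sig ≤ Lam 0 := by
  rintro g ⟨l, hg⟩
  exact ⟨fun _ => 0, l, Pd.zero' _, fun z => by simp [hg]⟩

lemma Lam_zero {g : Equiv.Perm (ℤ × ℤ)} (hg : g ∈ Lam 0) :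
    ∃ a b : ℤ, ∀ z, g z = (z.1 + a, z.2 + b) := by
  obtain ⟨Q, l, hQ, h⟩ := hg
  refine ⟨Q 0, l, fun z => ?_⟩
  have h1 := hQ z.2 0
  rw [h z]
  simp only [zero_add] at h1
  ext
  · simp only; linarith
  · rfl

lemma freq_finite {α ι : Type*} {f : Filter α} [f.NeBot] {A : Set ι} (hA : A.Finite)
    {P : ι → α → Prop} (h : ∀ᶠ z in f, ∃ g ∈ A, P g z) : ∃ g ∈ A, ∃ᶠ z in f, P g z := by
  by_contra hcon
  push Not at hcon
  have : ∀ᶠ z in f, ∀ g ∈ A, ¬ P g z := (Filter.eventually_all_finite hA).2 fun g hg => by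
    simpa using hcon g hg
  obtain ⟨z, hz, g, hg, hz'⟩ := (this.and h).exists
  exact hz g hg hz'

lemma InvF.freq {α : Type*} {G : Subgroup (Equiv.Perm α)} {f : Filter α} (hf : InvF G f)
    {g : Equiv.Perm α} (hg : g ∈ G) {P : α → Prop} (h : ∃ᶠ z in f, P (g z)) : ∃ᶠ z in f, P z :=
  fun hcon => h (hf g hg _ hcon)

theorem local_dense {X : Type*} [MetricSpace X] [CompactSpace X] {T : X ≃ₜ X}
    (hT : IsMinimalTDS T) [Nonempty X] {F : Set (ℤ → ℤ)} (hfin : F.Finite)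
    (hF : ∀ q ∈ F, (∃ k, Pd k q) ∧ q 0 = 0) {V V' : Set X}
    (hV' : IsOpen V') (hne : V'.Nonempty) (hsub : V' ⊆ V) :
    ∃ (r : ℕ) (U : Set X), IsOpen U ∧ U.Nonempty ∧ U ⊆ V' ∧
      ∀ L, U ⊆ closure (Av T F V r L) := by
  obtain ⟨x⟩ := ‹Nonempty X›
  -- common degree bound
  obtain ⟨D, hD⟩ : ∃ D, ∀ q ∈ F, Pd (D + 1) q := by
    have : ∀ q ∈ F, ∃ k, Pd k q := fun q hq => (hF q hq).1
    choose! k hk using this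
    obtain ⟨D, hD⟩ := (hfin.image k).bddAbove
    exact ⟨D, fun q hq => (hk q hq).mono ((hD ⟨q, hq, rfl⟩).trans (Nat.le_succ D))⟩
  have hF' : ∀ q ∈ insert (fun _ => 0) F, Pd (D + 1) q ∧ q 0 = 0 := by
    rintro q (rfl | hq)
    · exact ⟨Pd.zero' _, rfl⟩
    · exact ⟨hD q hq, (hF q hq).2⟩
  have hS := good_of_sol hT x D (Sol_all D _ (hfin.insert _) hF') (hfin.insert _) hF' V' hV' hne
  set E : Set (ℤ × ℤ) := {z | ∀ q ∈ insert (fun _ => 0) F, hpow T (z.1 + q z.2) x ∈ V'} with hEd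
  obtain ⟨f, hf, hfE⟩ := hS.exists_minF
  obtain ⟨A, hA1, hA2, hA3⟩ := hf.cover hfE
  have hfb := hf.1
  -- sets of points
  let Q : ℤ × ℕ → Set X := fun p => {y | ∀ L, hpow T p.1 y ∈ closure (Av T F V p.2 L ∩ V')}
  have hQclosed : ∀ p, IsClosed (Q p) := by
    intro p
    have : Q p = ⋂ L, hpow T p.1 ⁻¹' closure (Av T F V p.2 L ∩ V') := by
      ext y; simp [Q]
    rw [this]
    exact isClosed_iInter fun L => isClosed_closure.preimage (hpow_cont T _)
  have hQcover : ⋃ p, Q p = Set.univ := by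
    refine Set.eq_univ_of_forall fun y => ?_
    let fy : Filter (ℤ × ℤ) := f ⊓ Filter.comap (fun z => hpow T z.1 x) (𝓝 y)
    have hfyb : fy.NeBot := by
      rw [Filter.inf_neBot_iff_frequently_right]
      intro P hP
      obtain ⟨t, ht, htP⟩ := Filter.mem_comap.1 hP
      obtain ⟨t', ht't, ht'o, hyt'⟩ := mem_nhds_iff.1 ht
      obtain ⟨K, hK⟩ := exists_cover hT ht'o ⟨y, hyt'⟩
      obtain ⟨c, -, hc⟩ := freq_finite (f := f) K.finite_toSet
        (P := fun c z => hpow T (-c) (hpow T z.1 x) ∈ t')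
        (Filter.Eventually.of_forall fun z => hK (hpow T z.1 x))
      have h1 : ∃ᶠ z in f, hpow T (z : ℤ × ℤ).1 x ∈ t' := by
        refine hf.2.1.freq (lam_mem (k := 0) 0 (Pd.const 0 (-c))) ?_
        refine hc.mono fun z hz => ?_
        rw [lam_apply]
        simp only
        rwa [add_comm, hpow_add]
      exact h1.mono fun z hz => htP (ht't hz)
    have hfyi : InvF Sig fy := by
      rintro g ⟨l, hg⟩ s hs
      obtain ⟨s1, hs1, s2, hs2, rfl⟩ := Filter.mem_inf_iff.1 hs
      obtain ⟨t, ht, hts2⟩ := Filter.mem_comap.1 hs2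
      have h1 := hf.2.1 g (Sig_le ⟨l, hg⟩) s1 hs1
      have h2 : (fun z : ℤ × ℤ => hpow T z.1 x) ⁻¹' t ∈
          Filter.comap (fun z : ℤ × ℤ => hpow T z.1 x) (𝓝 y) := Filter.preimage_mem_comap ht
      refine Filter.mem_of_superset (Filter.inter_mem_inf h1 h2) ?_
      rintro z ⟨hz1, hz2⟩
      refine ⟨hz1, hts2 ?_⟩
      simp only [Set.mem_preimage, hg]
      exact hz2
    obtain ⟨m, hm, hmin⟩ := exists_minF Sig fy hfyb hfyi
    have hmb := hmin.1
    have h4 : ∀ᶠ z in m, ∃ g ∈ A, g z ∈ E := (hm.trans inf_le_left) hA3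
    obtain ⟨g, hgA, hg⟩ := freq_finite hA1 h4
    obtain ⟨a, b, hab⟩ := Lam_zero (hA2 g hgA)
    obtain ⟨B, hB1, hB2, hB3⟩ := hmin.cover (E := {z | g z ∈ E}) hg
    have : ∀ h ∈ B, ∃ l : ℤ, ∀ z, h z = (z.1, z.2 + l) := fun h hh => hB2 h hh
    choose! l hl using this
    obtain ⟨r, hr⟩ := (hB1.image (fun h => (l h + b).natAbs)).bddAbove
    have h5 : ∀ᶠ z in m, ∃ e ∈ Set.Icc (-(r : ℤ)) r, (z.1 + a, z.2 + e) ∈ E := by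
      filter_upwards [hB3] with z ⟨h, hh, hz⟩
      have h6 : (l h + b).natAbs ≤ r := hr ⟨h, hh, rfl⟩
      refine ⟨l h + b, ⟨by omega, by omega⟩, ?_⟩
      have hz' : g (h z) ∈ E := hz
      rw [hl h hh, hab] at hz'
      simpa only [add_assoc] using hz'
    refine Set.mem_iUnion.2 ⟨(a, r), fun L => ?_⟩
    rw [mem_closure_iff]
    intro N hN hyN
    have h7 : ∀ᶠ z in m, ∀ j ∈ Set.Icc (-(L : ℤ)) L, ∃ e ∈ Set.Icc (-(r : ℤ)) r,
        (z.1 + a, z.2 + j + e) ∈ E := by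
      refine (Filter.eventually_all_finite (Set.finite_Icc _ _)).2 fun j _ => ?_
      have := hmin.2.1 (lam (fun _ => 0) j) ⟨j, fun z => by simp [lam_apply]⟩ _ h5
      filter_upwards [this] with z hz
      simpa [lam_apply] using hz
    have h8 : ∀ᶠ z in m, hpow T (a + z.1) x ∈ N := by
      have h9 : hpow T a ⁻¹' N ∈ 𝓝 y := (hN.preimage (hpow_cont T a)).mem_nhds hyN
      have h10 := (hm.trans inf_le_right) (Filter.preimage_mem_comap h9)
      filter_upwards [h10] with z hz
      rw [hpow_add]; exact hz
    obtain ⟨z, hz7, hz8⟩ := (h7.and h8).exists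
    rw [add_comm] at hz8
    refine ⟨_, hz8, ⟨z.2, fun j hj => ?_⟩, ?_⟩
    · obtain ⟨e, he, heE⟩ := hz7 j hj
      refine ⟨e, he, fun q hq => ?_⟩
      have := heE q (Or.inr hq)
      simp only at this
      rw [add_comm, hpow_add] at this
      exact hsub this
    · obtain ⟨e, he, heE⟩ := hz7 0 ⟨by simp, by simp⟩
      have := heE _ (Or.inl rfl)
      simpa using this
  obtain ⟨⟨a, r⟩, hp⟩ := nonempty_interior_of_iUnion_of_closed hQclosed hQcover
  have hopen : IsOpen (hpow T (-a) ⁻¹' interior (Q (a, r))) :=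
    isOpen_interior.preimage (hpow_cont T _)
  have hU : ∀ y ∈ hpow T (-a) ⁻¹' interior (Q (a, r)),
      ∀ L, y ∈ closure (Av T F V r L ∩ V') := by
    intro y hy L
    have := interior_subset hy L
    simp only at this
    rwa [← hpow_add, add_neg_cancel, hpow_zero] at this
  refine ⟨r, (hpow T (-a) ⁻¹' interior (Q (a, r))) ∩ V', hopen.inter hV', ?_,
    Set.inter_subset_right, fun L y hy => closure_mono Set.inter_subset_left (hU y hy.1 L)⟩
  obtain ⟨y, hy⟩ := hp
  have hy' : hpow T a y ∈ hpow T (-a) ⁻¹' interior (Q (a, r)) := by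
    rw [Set.mem_preimage, ← hpow_add, neg_add_cancel, hpow_zero]; exact hy
  obtain ⟨w, hw1, hw2⟩ := mem_closure_iff.1 (hU _ hy' 0) _ hopen hy'
  exact ⟨w, hw1, hw2.2⟩

lemma residual_frontier {X : Type*} [TopologicalSpace X] {U : Set X} (hU : IsOpen U) :
    (frontier U)ᶜ ∈ residual X := by
  refine residual_of_dense_open isClosed_frontier.isOpen_compl ?_
  rw [← interior_eq_empty_iff_dense_compl]
  exact interior_frontier hU.isClosed_compl |> fun h => by simpa using h

theorem generic_ps {X : Type*} [MetricSpace X] [CompactSpace X] {T : X ≃ₜ X}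
    (hT : IsMinimalTDS T) [Nonempty X] {F : Set (ℤ → ℤ)} (hfin : F.Finite)
    (hF : ∀ q ∈ F, (∃ k, Pd k q) ∧ q 0 = 0) {V : Set X} (hV : IsOpen V) :
    ∀ᶠ x in residual X, x ∈ V → ∃ r, ∀ L, x ∈ Av T F V r L := by
  let D : Set X := ⋃ r : ℕ, interior (⋂ L : ℕ, closure (Av T F V r L))
  have hD : IsOpen D := isOpen_iUnion fun r => isOpen_interior
  have h1 : ∀ᶠ x in residual X, ∀ r L, x ∈ (frontier (Av T F V r L))ᶜ :=
    eventually_countable_forall.2 fun r => eventually_countable_forall.2 fun L =>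
      residual_frontier (Av_open T hfin hV r L)
  filter_upwards [h1, residual_frontier hD] with x hx hxD hxV
  have hxcl : x ∈ closure D := by
    rw [mem_closure_iff]
    intro N hN hxN
    obtain ⟨r, U, hU, ⟨y, hy⟩, hUV, hUL⟩ := local_dense hT hfin hF (hN.inter hV) ⟨x, hxN, hxV⟩
      (Set.inter_subset_right : N ∩ V ⊆ V)
    refine ⟨y, (hUV hy).1, Set.mem_iUnion.2 ⟨r, ?_⟩⟩
    exact interior_maximal (Set.subset_iInter hUL) hU hy
  have hxD' : x ∈ D := by
    by_contra h
    exact hxD ⟨hxcl, by rwa [hD.interior_eq]⟩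
  obtain ⟨r, hr⟩ := Set.mem_iUnion.1 hxD'
  refine ⟨r, fun L => ?_⟩
  by_contra h
  refine hx r L ⟨Set.mem_iInter.1 (interior_subset hr) L, ?_⟩
  rwa [(Av_open T hfin hV r L).interior_eq]

/-! ### Minimal points of topological systems -/

lemma zorbit_closure_inv {Z : Type*} [TopologicalSpace Z] (S : Z ≃ₜ Z) (z w : Z)
    (hw : w ∈ closure (zorbit S z)) (m : ℤ) : hpow S m w ∈ closure (zorbit S z) := by
  refine closure_minimal (t := hpow S m ⁻¹' closure (zorbit S z)) ?_
    (isClosed_closure.preimage (hpow_cont S m)) hw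
  rintro _ ⟨n, rfl⟩
  refine subset_closure ⟨m + n, ?_⟩
  simp only [hpow_add]

lemma exists_minimal_point {Z : Type*} [TopologicalSpace Z] [CompactSpace Z] (S : Z ≃ₜ Z)
    {Y : Set Z} (hY : IsClosed Y) (hne : Y.Nonempty) (hinv : ∀ y ∈ Y, ∀ m, hpow S m y ∈ Y) :
    ∃ M ⊆ Y, M.Nonempty ∧ (∀ y ∈ M, ∀ m, hpow S m y ∈ M) ∧ ∀ y ∈ M, IsMinimalPoint S y := by
  obtain ⟨M, hMY, hM⟩ := zorn_superset_nonempty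
    {K : Set Z | IsClosed K ∧ K.Nonempty ∧ ∀ y ∈ K, ∀ m, hpow S m y ∈ K} (by
      intro c hc hchain hcne
      refine ⟨⋂₀ c, ⟨isClosed_sInter fun K hK => (hc hK).1, ?_, ?_⟩,
        fun s hs => Set.sInter_subset_of_mem hs⟩
      · have : Nonempty c := hcne.to_subtype
        refine IsCompact.nonempty_sInter_of_directed_nonempty_isCompact_isClosed ?_
          (fun K hK => (hc hK).2.1) (fun K hK => (hc hK).1.isCompact) (fun K hK => (hc hK).1)
        intro s hs t ht
        rcases hchain.total hs ht with h | h
        · exact ⟨s, hs, le_refl _, h⟩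
        · exact ⟨t, ht, h, le_refl _⟩
      · intro y hy m K hK
        exact (hc hK).2.2 y (hy K hK) m) Y ⟨hY, hne, hinv⟩
  obtain ⟨hMc, hMne, hMi⟩ := hM.prop
  have key : ∀ y ∈ M, closure (zorbit S y) = M := by
    intro y hy
    have h1 : closure (zorbit S y) ⊆ M := by
      refine closure_minimal ?_ hMc
      rintro _ ⟨n, rfl⟩
      exact hMi y hy n
    refine h1.antisymm (hM.le_of_le ⟨isClosed_closure, ⟨y, subset_closure ⟨0, ?_⟩⟩, ?_⟩ h1)
    · exact hpow_zero S y
    · intro w hw m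
      exact zorbit_closure_inv S y w hw m
  refine ⟨M, hMY, hMne, hMi, fun y hy w hw => ?_⟩
  rw [key y hy] at hw ⊢
  exact key w hw

/-- Piecewise syndetic visits to a closed set produce a minimal point in it. -/
lemma minimal_of_ps {Z : Type*} [TopologicalSpace Z] [CompactSpace Z] (S : Z ≃ₜ Z) (z : Z)
    {C : Set Z} (hC : IsClosed C) (r : ℕ)
    (h : ∀ L : ℕ, ∃ m : ℤ, ∀ l ∈ Set.Icc (-(L : ℤ)) L, ∃ f ∈ Set.Icc (-(r : ℤ)) r,
      hpow S (m + l + f) z ∈ C) :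
    ∃ w ∈ C, w ∈ closure (zorbit S z) ∧ IsMinimalPoint S w := by
  choose m hm using h
  let B : Set Z := {w | ∃ f ∈ Set.Icc (-(r : ℤ)) r, hpow S f w ∈ C}
  have hB : IsClosed B := by
    have : B = ⋃ f ∈ Set.Icc (-(r : ℤ)) r, hpow S f ⁻¹' C := by
      ext w; simp [B]
    rw [this]
    exact (Set.finite_Icc _ _).isClosed_biUnion fun f _ => hC.preimage (hpow_cont S f)
  let Y : Set Z := closure (zorbit S z) ∩ ⋂ l : ℤ, hpow S l ⁻¹' B
  have hY : IsClosed Y := isClosed_closure.inter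
    (isClosed_iInter fun l => hB.preimage (hpow_cont S l))
  have hYi : ∀ y ∈ Y, ∀ n, hpow S n y ∈ Y := by
    rintro y ⟨hy1, hy2⟩ n
    refine ⟨zorbit_closure_inv S z y hy1 n, ?_⟩
    simp only [Set.mem_iInter, Set.mem_preimage] at hy2 ⊢
    intro l
    rw [← hpow_add]
    exact hy2 _
  have hYne : Y.Nonempty := by
    obtain ⟨w, -, hw⟩ := (isCompact_univ (X := Z)).exists_mapClusterPt (f := Filter.atTop)
      (u := fun L : ℕ => hpow S (m L) z) (by simp)
    refine ⟨w, ?_, ?_⟩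
    · exact isClosed_closure.mem_of_mapClusterPt hw
        (Filter.Eventually.of_forall fun L => subset_closure ⟨m L, rfl⟩)
    · simp only [Set.mem_iInter]
      intro l
      refine (hB.preimage (hpow_cont S l)).mem_of_mapClusterPt hw ?_
      filter_upwards [Filter.eventually_ge_atTop l.natAbs] with L hL
      obtain ⟨f, hf, hf'⟩ := hm L l ⟨by omega, by omega⟩
      refine ⟨f, hf, ?_⟩
      rw [← hpow_add, ← hpow_add]
      convert hf' using 2
      ring
  obtain ⟨M, hMY, ⟨y, hy⟩, hMi, hMm⟩ := exists_minimal_point S hY hYne hYi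
  have h1 := (hMY hy).2
  simp only [Set.mem_iInter, Set.mem_preimage] at h1
  obtain ⟨f, -, hf⟩ := h1 0
  rw [hpow_zero] at hf
  exact ⟨_, hf, (hMY (hMi y hy f)).1, hMm _ (hMi y hy f)⟩

/-! ### The main theorem -/

lemma zorbit_hpow {Z : Type*} [TopologicalSpace Z] (S : Z ≃ₜ Z) (n : ℤ) (z : Z) :
    zorbit S (hpow S n z) = zorbit S z := by
  ext w
  constructor
  · rintro ⟨m, rfl⟩
    exact ⟨m + n, hpow_add S m n z⟩
  · rintro ⟨m, rfl⟩
    refine ⟨m - n, ?_⟩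
    simp only
    rw [← hpow_add, sub_add_cancel]

lemma IsMinimalPoint.hpow {Z : Type*} [TopologicalSpace Z] {S : Z ≃ₜ Z} {z : Z}
    (h : IsMinimalPoint S z) (n : ℤ) : IsMinimalPoint S (hpow S n z) := by
  unfold IsMinimalPoint at h ⊢
  rwa [zorbit_hpow]

/-- Finite sets of integral polynomials vanishing at `0`. -/
def FinFam : Set (Set (ℤ → ℤ)) :=
  {F | F.Finite ∧ F ⊆ {q | (∃ k, Pd k q) ∧ q 0 = 0}}

lemma FinFam_countable : FinFam.Countable := by
  refine Set.countable_ofPred_finite_subset ?_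
  refine Set.Countable.mono (s₂ := ⋃ k, {q | Pd k q}) ?_ (Set.countable_iUnion countable_Pd)
  rintro q ⟨⟨k, hk⟩, -⟩
  exact Set.mem_iUnion.2 ⟨k, hk⟩

lemma mem_closure_minimal {X : Type*} [MetricSpace X] [CompactSpace X] {T : X ≃ₜ X} {x : X}
    (hx : ∀ F ∈ FinFam, ∀ V ∈ TopologicalSpace.countableBasis X, x ∈ V →
      ∃ r, ∀ L, x ∈ Av T F V r L)
    {d : ℕ} {p : Fin d → ℤ → ℤ} (hp : ∀ i, ∃ k, Pd k (p i)) :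
    (fun n j => hpow T (p j n) x) ∈ closure {a : ℤ → Fin d → X |
      a ∈ closure (zorbit (shiftH (Fin d → X)) (fun n j => hpow T (p j n) x)) ∧
      IsMinimalPoint (shiftH (Fin d → X)) a} := by
  rw [mem_closure_iff_nhds]
  intro O hO
  rw [nhds_pi, Filter.mem_pi] at hO
  obtain ⟨I, hI, t, ht, hsubO⟩ := hO
  have hu : ∀ n, ∃ u : Fin d → Set X, (∀ j, u j ∈ 𝓝 (hpow T (p j n) x)) ∧
      Set.univ.pi u ⊆ t n := by
    intro n
    have h1 := ht n
    rw [nhds_pi, Filter.mem_pi] at h1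
    obtain ⟨J, -, u, hu, hJ⟩ := h1
    exact ⟨u, hu, fun z hz => hJ fun j _ => hz j trivial⟩
  choose u hu hut using hu
  have hN : (⋂ n ∈ I, ⋂ j, hpow T (p j n) ⁻¹' u n j) ∈ 𝓝 x :=
    (Filter.biInter_mem hI).2 fun n _ => Filter.iInter_mem.2 fun j =>
      (hpow_cont T (p j n)).continuousAt (hu n j)
  obtain ⟨K, hK, hKc, hKN⟩ := exists_mem_nhds_isClosed_subset hN
  obtain ⟨V, hV, hxV, hVK⟩ :=
    (TopologicalSpace.isBasis_countableBasis X).mem_nhds_iff.1 hK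
  let F : Set (ℤ → ℤ) := Set.image2 (fun n j m => p j (m + n) - p j n) I Set.univ
  have hF : F ∈ FinFam := by
    refine ⟨Set.Finite.image2 _ hI Set.finite_univ, ?_⟩
    rintro _ ⟨n, -, j, -, rfl⟩
    obtain ⟨k, hk⟩ := hp j
    exact ⟨⟨k + 1, (hk.succ.shift n).sub (Pd.const k _)⟩, by simp⟩
  obtain ⟨r, hr⟩ := hx F hF V hV hxV
  let C : Set (ℤ → Fin d → X) := {z | ∀ n ∈ I, ∀ j, hpow T (-(p j n)) (z n j) ∈ K}
  have hC : IsClosed C := by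
    have : C = ⋂ n ∈ I, ⋂ j, (fun z : ℤ → Fin d → X => hpow T (-(p j n)) (z n j)) ⁻¹' K := by
      ext z; simp [C]
    rw [this]
    refine isClosed_biInter fun n _ => isClosed_iInter fun j => hKc.preimage ?_
    exact (hpow_cont T _).comp ((continuous_apply j).comp (continuous_apply n))
  obtain ⟨w, hwC, hw1, hw2⟩ := minimal_of_ps (shiftH (Fin d → X))
    (fun n j => hpow T (p j n) x) hC r (by
      intro L
      obtain ⟨m, hm⟩ := hr L
      refine ⟨m, fun l hl => ?_⟩
      obtain ⟨f, hf, h⟩ := hm l hl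
      refine ⟨f, hf, fun n hn j => ?_⟩
      rw [hpow_shift, ← hpow_add]
      have := h _ ⟨n, hn, j, trivial, rfl⟩
      simp only at this
      refine hVK ?_
      convert this using 2
      rw [add_comm n]; ring)
  refine ⟨w, hsubO fun n hn => hut n fun j _ => ?_, hw1, hw2⟩
  have h1 := hKN (hwC n hn j)
  simp only [Set.mem_iInter, Set.mem_preimage] at h1
  have h2 := h1 n hn j
  rwa [← hpow_add, add_neg_cancel, hpow_zero] at h2

/-- **Theorem (HSY22-1, Corollary 6.3).** Let `(X,T)` be a minimal t.d.s. There is a dense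
`Gδ` subset `X₀` of `X` such that for each `x ∈ X₀` and each family `A = {p 0, …, p (d-1)}`
of integral polynomials satisfying condition `(♠)` with `deg (p i) ≥ 2` for every `i`, the
system `(W_x^A, σ)` is an M-system, where `W_x^A` is the orbit closure of
`ω_x^A = ((T^{p 0 (n)} x, …, T^{p (d-1) (n)} x))_{n ∈ ℤ}` under the shift `σ`: it is
shift-invariant, transitive, and its minimal points are dense. -/
theorem Wx_is_M_system
    {X : Type*} [MetricSpace X] [CompactSpace X] (T : X ≃ₜ X) (hT : IsMinimalTDS T) :
    ∃ X₀ : Set X, IsGδ X₀ ∧ Dense X₀ ∧ ∀ x ∈ X₀,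
      ∀ (d : ℕ) (p : Fin d → ℤ → ℤ), SpadeCondition p →
        (∀ i, ∃ q : Polynomial ℚ, (∀ n : ℤ, (p i n : ℚ) = q.eval (n : ℚ)) ∧
          2 ≤ q.natDegree) →
        (∀ a ∈ closure (zorbit (shiftH (Fin d → X)) (fun n j => hpow T (p j n) x)),
          ∀ m : ℤ, hpow (shiftH (Fin d → X)) m a ∈
            closure (zorbit (shiftH (Fin d → X)) (fun n j => hpow T (p j n) x))) ∧
        (∃ a ∈ closure (zorbit (shiftH (Fin d → X)) (fun n j => hpow T (p j n) x)),
          closure (zorbit (shiftH (Fin d → X)) (fun n j => hpow T (p j n) x)) ⊆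
            closure (zorbit (shiftH (Fin d → X)) a)) ∧
        closure (zorbit (shiftH (Fin d → X)) (fun n j => hpow T (p j n) x)) ⊆
          closure {a : ℤ → Fin d → X |
            a ∈ closure (zorbit (shiftH (Fin d → X)) (fun n j => hpow T (p j n) x)) ∧
            IsMinimalPoint (shiftH (Fin d → X)) a} := by
  rcases isEmpty_or_nonempty X with hX | hX
  · exact ⟨Set.univ, IsGδ.univ, dense_univ, fun x => (hX.false x).elim⟩
  have hres : ∀ᶠ x in residual X, ∀ F ∈ FinFam, ∀ V ∈ TopologicalSpace.countableBasis X,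
      x ∈ V → ∃ r, ∀ L, x ∈ Av T F V r L := by
    refine (eventually_countable_ball FinFam_countable).2 fun F hF => ?_
    refine (eventually_countable_ball (TopologicalSpace.countable_countableBasis X)).2
      fun V hV => ?_
    exact generic_ps hT hF.1 (fun q hq => hF.2 hq)
      (TopologicalSpace.isOpen_of_mem_countableBasis hV)
  obtain ⟨X₀, hsub, hG, hD⟩ := mem_residual.1 hres
  refine ⟨X₀, hG, hD, fun x hx d p _ hpoly => ?_⟩
  have hp : ∀ i, ∃ k, Pd k (p i) := by
    intro i
    obtain ⟨q, hq, -⟩ := hpoly i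
    refine ⟨q.natDegree + 1, Pd_of_poly _ q (p i) ?_ hq⟩
    exact lt_of_le_of_lt Polynomial.degree_le_natDegree (by exact_mod_cast Nat.lt_succ_self _)
  have hmem := mem_closure_minimal (hsub hx) hp
  refine ⟨fun a ha m => zorbit_closure_inv _ _ a ha m,
    ⟨_, subset_closure ⟨0, hpow_zero _ _⟩, Set.Subset.refl _⟩, ?_⟩
  refine closure_minimal ?_ isClosed_closure
  rintro _ ⟨n, rfl⟩
  refine map_mem_closure (hpow_cont (shiftH (Fin d → X)) n) hmem ?_
  rintro a ⟨ha1, ha2⟩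
  exact ⟨zorbit_closure_inv _ _ a ha1 n, ha2.hpow n⟩
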